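/- arXiv:2106.00555 — 2 statements merged into one kernel-verified Lean document; each statement's English description precedes it below -/
import Mathlib

section
/- Let x be a random vector in ℝ^m whose law is the spherical Gaussian mixture Σ_{j=1}^r ω_j N(μ_j, σ_j² I_m) with r ≤ m, set μ̄ = E[x] and σ̃² = Σ_{j=1}^r ω_j σ_j², and let v ∈ ℝ^m be a unit eigenvector of the covariance matrix E[(x − μ̄)(x − μ̄)^T] for the eigenvalue σ̃². Then, as an identity of linear forms in X = (X_1,…,X_m): E[(x·X)(v·(x − μ̄))²] = Σ_{j=1}^r ω_j σ_j² (μ_j·X). -/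
open MeasureTheory ProbabilityTheory

/-- The spherical Gaussian measure `N(μ, σ² I_m)` on `ℝ^m`: the law of `μ + σ g` where `g`
is a standard Gaussian vector. -/
noncomputable def sphericalGaussian (m : ℕ) (μ : Fin m → ℝ) (σ : ℝ) :
    Measure (Fin m → ℝ) :=
  Measure.map (fun g => μ + σ • g) (Measure.pi fun _ => gaussianReal 0 1)

/-- The spherical Gaussian mixture `Σ_j ω_j N(μ_j, σ_j² I_m)` on `ℝ^m`. -/
noncomputable def sphericalMixture {r m : ℕ} (ω : Fin r → ℝ) (μ : Fin r → Fin m → ℝ)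
    (σ : Fin r → ℝ) : Measure (Fin m → ℝ) :=
  ∑ j, ENNReal.ofReal (ω j) • sphericalGaussian m (μ j) (σ j)

/-- The mean vector `E[x]` of a measure on `ℝ^m`. -/
noncomputable def meanVec {m : ℕ} (P : Measure (Fin m → ℝ)) : Fin m → ℝ :=
  fun i => ∫ x, x i ∂P

/-- The covariance matrix `E[(x - E[x])(x - E[x])^T]` of a measure on `ℝ^m`. -/
noncomputable def covMatrix {m : ℕ} (P : Measure (Fin m → ℝ)) : Matrix (Fin m) (Fin m) ℝ :=
  fun i l => ∫ x, (x i - meanVec P i) * (x l - meanVec P l) ∂P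

/-- The linear form `u·X = u₁X₁ + ⋯ + uₘXₘ` with real coefficients. -/
noncomputable def linFormR {m : ℕ} (v : Fin m → ℝ) : MvPolynomial (Fin m) ℝ :=
  ∑ i, MvPolynomial.C (v i) * MvPolynomial.X i


/-- The standard Gaussian on `ℝ^m`. -/
noncomputable def stdG (m : ℕ) : Measure (Fin m → ℝ) := Measure.pi fun _ => gaussianReal 0 1

instance stdG_prob (m : ℕ) : IsProbabilityMeasure (stdG m) := by
  unfold stdG; infer_instance

lemma stdG_memLp {m : ℕ} (i : Fin m) (p : NNReal) : MemLp (fun g : Fin m → ℝ => g i) p (stdG m) :=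
  (memLp_id_gaussianReal (μ := 0) (v := 1) p).comp_measurePreserving
    (measurePreserving_eval (fun _ : Fin m => gaussianReal 0 1) i)

lemma stdG_memLp_lin {m : ℕ} (v : Fin m → ℝ) (p : NNReal) :
    MemLp (fun g : Fin m → ℝ => ∑ l, v l * g l) p (stdG m) :=
  memLp_finsetSum _ fun l _ => (stdG_memLp l p).const_mul (v l)

lemma stdG_neg (m : ℕ) : MeasurePreserving (fun g : Fin m → ℝ => -g) (stdG m) (stdG m) := by
  have := measurePreserving_pi (fun _ : Fin m => gaussianReal 0 1)
    (fun _ : Fin m => gaussianReal 0 1) (f := fun _ x => -x)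
    (fun i => ⟨by fun_prop, by simpa using gaussianReal_map_neg (μ := 0) (v := 1)⟩)
  exact this

lemma stdG_odd {m : ℕ} (f : (Fin m → ℝ) → ℝ) (hf : ∀ g, f (-g) = - f g) :
    ∫ g, f g ∂(stdG m) = 0 := by
  have h := (stdG_neg m).integral_comp (MeasurableEquiv.neg (Fin m → ℝ)).measurableEmbedding f
  simp only [hf, integral_neg] at h
  linarith

lemma stdG_sq {m : ℕ} (v : Fin m → ℝ) :
    ∫ g, (∑ l, v l * g l) ^ 2 ∂(stdG m) = ∑ l, v l ^ 2 := by
  have h := variance_sum_pi (μ := fun _ : Fin m => gaussianReal 0 1) (X := fun l x => v l * x)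
    (fun l => ((memLp_id_gaussianReal (μ := 0) (v := 1) 2).const_mul (v l)))
  have h2 : (∑ i : Fin m, fun ω : Fin m → ℝ => v i * ω i) = fun g => ∑ l, v l * g l := by
    ext g; simp
  rw [h2, variance_of_integral_eq_zero (Continuous.aemeasurable (by fun_prop))] at h
  · rw [stdG, h]
    refine Finset.sum_congr rfl fun l _ => ?_
    rw [variance_const_mul]
    simp
  · exact stdG_odd _ (fun g => by simp)

lemma mix_integral {r m : ℕ} (ω : Fin r → ℝ) (hω : ∀ j, 0 < ω j) (μ : Fin r → Fin m → ℝ)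
    (σ : Fin r → ℝ) (f : (Fin m → ℝ) → ℝ) (hf : Continuous f)
    (hi : ∀ j, Integrable (fun g => f (μ j + σ j • g)) (stdG m)) :
    Integrable f (sphericalMixture ω μ σ) ∧
    ∫ x, f x ∂(sphericalMixture ω μ σ) = ∑ j, ω j * ∫ g, f (μ j + σ j • g) ∂(stdG m) := by
  have h1 : ∀ j, Integrable f (sphericalGaussian m (μ j) (σ j)) := fun j => by
    unfold sphericalGaussian
    rw [integrable_map_measure hf.aestronglyMeasurable (by fun_prop)]
    exact hi j
  have h2 : ∀ j, Integrable f (ENNReal.ofReal (ω j) • sphericalGaussian m (μ j) (σ j)) :=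
    fun j => (h1 j).smul_measure ENNReal.ofReal_ne_top
  unfold sphericalMixture
  refine ⟨integrable_finsetSum_measure.2 fun j _ => h2 j, ?_⟩
  rw [integral_finsetSum_measure fun j _ => h2 j]
  refine Finset.sum_congr rfl fun j _ => ?_
  rw [integral_smul_measure, ENNReal.toReal_ofReal (hω j).le, smul_eq_mul]
  unfold sphericalGaussian
  rw [integral_map (by fun_prop) hf.aestronglyMeasurable]
  rfl

open MvPolynomial in
/-- if v is a unit eigenvector of the covariance matrix for the eigenvalue
σ̃² = Σ_j ω_j σ_j², then E[(x·X)(v·(x-μ̄))²] = Σ_j ω_j σ_j² (μ_j·X) as linear forms. -/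
theorem statement_2 (m r : ℕ) (hrm : r ≤ m)
    (ω : Fin r → ℝ) (hω : ∀ j, 0 < ω j) (hωsum : ∑ j, ω j = 1)
    (μ : Fin r → Fin m → ℝ) (σ : Fin r → ℝ) (hσ : ∀ j, 0 < σ j)
    (P : Measure (Fin m → ℝ)) (hP : P = sphericalMixture ω μ σ)
    (v : Fin m → ℝ) (hv : ∑ i, v i ^ 2 = 1)
    (hveig : (covMatrix P).mulVec v = (∑ j, ω j * σ j ^ 2) • v) :
    (∑ i, C (∫ x, x i * (∑ l, v l * (x l - meanVec P l)) ^ 2 ∂P) * X i)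
      = ∑ j, C (ω j * σ j ^ 2) * linFormR (μ j) := by
  have haff : ∀ j (x : Fin m → ℝ), ∑ l, v l * ((μ j + σ j • x) l - meanVec P l)
      = (∑ l, v l * (μ j l - meanVec P l)) + σ j * ∑ l, v l * x l := fun j x => by
    rw [Finset.mul_sum, ← Finset.sum_add_distrib]
    refine Finset.sum_congr rfl fun l _ => ?_
    simp only [Pi.add_apply, Pi.smul_apply, smul_eq_mul]
    ring
  have hL1 : Integrable (fun g : Fin m → ℝ => ∑ l, v l * g l) (stdG m) :=
    (stdG_memLp_lin v 1).integrable (by simp)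
  have hL2 : Integrable (fun g : Fin m → ℝ => (∑ l, v l * g l) ^ 2) (stdG m) :=
    (stdG_memLp_lin v 2).integrable_sq
  have hL4 : MemLp (fun g : Fin m → ℝ => (∑ l, v l * g l) ^ 2) 2 (stdG m) := by
    rw [memLp_two_iff_integrable_sq (Continuous.aestronglyMeasurable (by fun_prop))]
    have h4 := (stdG_memLp_lin v 4).integrable_norm_pow (p := 4) (by norm_num)
    refine h4.congr (Filter.Eventually.of_forall fun g => ?_)
    simp only [Real.norm_eq_abs]
    rw [← pow_mul, Even.pow_abs (by decide)]
  have hL3 : ∀ i, Integrable (fun g : Fin m → ℝ => g i * (∑ l, v l * g l) ^ 2) (stdG m) :=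
    fun i => MemLp.integrable_mul (p := 2) (q := 2) (stdG_memLp i 2) hL4
  -- the variance in direction `v`
  have hcoord : ∀ i l, Integrable
      (fun x : Fin m → ℝ => (x i - meanVec P i) * (x l - meanVec P l)) P := fun i l => by
    have hm : ∀ j i, MemLp (fun g : Fin m → ℝ => (μ j + σ j • g) i - meanVec P i) 2 (stdG m) :=
      fun j i => ((memLp_const (μ j i)).add ((stdG_memLp i 2).const_mul (σ j))).sub (memLp_const _)
    have := (mix_integral ω hω μ σ
      (fun x : Fin m → ℝ => (x i - meanVec P i) * (x l - meanVec P l)) (by fun_prop)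
      (fun j => (hm j i).integrable_mul (hm j l))).1
    rwa [← hP] at this
  have hvar : ∫ x, (∑ l, v l * (x l - meanVec P l)) ^ 2 ∂P = ∑ j, ω j * σ j ^ 2 := by
    have e1 : ∀ x : Fin m → ℝ, (∑ l, v l * (x l - meanVec P l)) ^ 2
        = ∑ i, ∑ l, (v i * v l) * ((x i - meanVec P i) * (x l - meanVec P l)) := fun x => by
      rw [sq, Finset.sum_mul_sum]
      refine Finset.sum_congr rfl fun i _ => Finset.sum_congr rfl fun l _ => by ring
    simp_rw [e1]
    rw [integral_finsetSum _ fun i _ => integrable_finsetSum _ fun l _ => (hcoord i l).const_mul _]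
    have e2 : ∀ i, ∫ x, ∑ l, (v i * v l) * ((x i - meanVec P i) * (x l - meanVec P l)) ∂P
        = v i * ((∑ j, ω j * σ j ^ 2) * v i) := fun i => by
      rw [integral_finsetSum _ fun l _ => (hcoord i l).const_mul _]
      have := congrFun hveig i
      simp only [Matrix.mulVec, dotProduct, covMatrix, Pi.smul_apply, smul_eq_mul] at this
      rw [← this, Finset.mul_sum]
      refine Finset.sum_congr rfl fun l _ => ?_
      rw [integral_const_mul]
      ring
    simp_rw [e2]
    calc _ = (∑ j, ω j * σ j ^ 2) * ∑ i, v i ^ 2 := by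
          rw [Finset.mul_sum]
          exact Finset.sum_congr rfl fun i _ => by ring
      _ = _ := by rw [hv, mul_one]
  have hsq : ∀ (a s : ℝ), Integrable (fun g : Fin m → ℝ => (a + s * ∑ l, v l * g l) ^ 2) (stdG m)
      ∧ ∫ g, (a + s * ∑ l, v l * g l) ^ 2 ∂(stdG m) = a ^ 2 + s ^ 2 := fun a s => by
    have e : ∀ g : Fin m → ℝ, (a + s * ∑ l, v l * g l) ^ 2
      = a ^ 2 + (2 * a * s) * (∑ l, v l * g l) + s ^ 2 * (∑ l, v l * g l) ^ 2 := fun g => by ring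
    simp_rw [e]
    have i1 : Integrable (fun g : Fin m → ℝ => a ^ 2 + (2 * a * s) * (∑ l, v l * g l)) (stdG m) :=
      (integrable_const (μ := stdG m) (a ^ 2)).add (hL1.const_mul (2 * a * s))
    refine ⟨i1.add (hL2.const_mul (s ^ 2)), ?_⟩
    rw [integral_add i1 (hL2.const_mul (s ^ 2)),
      integral_add (integrable_const _) (hL1.const_mul _), integral_const_mul, integral_const_mul,
      stdG_sq, hv, stdG_odd (fun g : Fin m → ℝ => ∑ l, v l * g l) (fun g => by simp)]
    simp
  have hzero : ∀ j, ∑ l, v l * (μ j l - meanVec P l) = 0 := by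
    have h := (mix_integral ω hω μ σ
      (fun x : Fin m → ℝ => (∑ l, v l * (x l - meanVec P l)) ^ 2) (by fun_prop)
      (fun j => by simp_rw [haff]; exact (hsq _ _).1)).2
    rw [← hP, hvar] at h
    simp_rw [haff, (hsq _ _).2, mul_add, Finset.sum_add_distrib] at h
    have h0 : ∑ j, ω j * (∑ l, v l * (μ j l - meanVec P l)) ^ 2 = 0 := by
      simp_rw [mul_sub] at h ⊢
      simp only [Finset.sum_sub_distrib] at h ⊢
      linarith
    intro j
    have h1 := (Finset.sum_eq_zero_iff_of_nonneg
      (fun j _ => mul_nonneg (hω j).le (sq_nonneg _))).1 h0 j (Finset.mem_univ j)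
    have h2 := (mul_eq_zero.1 h1).resolve_left (hω j).ne'
    exact pow_eq_zero_iff (two_ne_zero) |>.1 h2
  have hmain : ∀ i, ∫ x, x i * (∑ l, v l * (x l - meanVec P l)) ^ 2 ∂P
      = ∑ j, ω j * σ j ^ 2 * μ j i := fun i => by
    have e : ∀ j (g : Fin m → ℝ), (μ j + σ j • g) i *
        (∑ l, v l * ((μ j + σ j • g) l - meanVec P l)) ^ 2
        = (μ j i * σ j ^ 2) * (∑ l, v l * g l) ^ 2
          + σ j ^ 3 * (g i * (∑ l, v l * g l) ^ 2) := fun j g => by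
      rw [haff, hzero]
      simp only [Pi.add_apply, Pi.smul_apply, smul_eq_mul]
      ring
    have h := (mix_integral ω hω μ σ
      (fun x : Fin m → ℝ => x i * (∑ l, v l * (x l - meanVec P l)) ^ 2) (by fun_prop)
      (fun j => by
        simp_rw [e]
        exact (hL2.const_mul _).add ((hL3 i).const_mul _))).2
    rw [← hP] at h
    rw [h]
    refine Finset.sum_congr rfl fun j _ => ?_
    simp_rw [e]
    rw [integral_add (hL2.const_mul _) ((hL3 i).const_mul _), integral_const_mul,
      integral_const_mul, stdG_sq, hv, stdG_odd _ (fun g => by simp)]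
    ring
  simp_rw [hmain, linFormR, Finset.mul_sum, map_sum, Finset.sum_mul]
  rw [Finset.sum_comm]
  refine Finset.sum_congr rfl fun j _ => Finset.sum_congr rfl fun i _ => ?_
  rw [C_mul, mul_assoc]
end

section
/- Let T ∈ ℂ[X]_d with T = Σ_{i=1}^r ω_i (ξ_i·X)^d, ω_i ∈ ℂ nonzero, ξ_i ∈ ℂ^m nonzero spanning pairwise distinct lines, and suppose rank H_T^{k,d−k} = r for some k with ι(ξ_1,…,ξ_r) + 1 ≤ k ≤ d. Let s_k = C(m+k−1, k), let U ∈ ℂ^{s_k × r} be any matrix whose column space equals the column space of H_T^{k,d−k}, and for i ∈ {1,…,m} let U_i ∈ ℂ^{s_{k−1} × r} be the submatrix of U formed by the rows indexed by exponents of the form e_i + α with |α| = k−1 (e_i the i-th unit exponent). Then there exist invertible matrices E ∈ ℂ^{s_{k−1} × s_{k−1}} and F ∈ ℂ^{r × r} such that for every i ∈ {1,…,m}, E^t U_i F is the s_{k−1} × r matrix whose top r × r block is diag(conj(ξ_{1,i}),…,conj(ξ_{r,i})) and whose remaining rows are zero. -/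
open MvPolynomial Matrix

/-- The linear form `v·X = v₁X₁ + ⋯ + vₘXₘ`. -/
noncomputable def linForm {m : ℕ} (v : Fin m → ℂ) : MvPolynomial (Fin m) ℂ :=
  ∑ i, C (v i) * X i

/-- The apolar product `⟨p,q⟩_d = Σ_{|α|=d} C(d,α) conj(p_α) q_α` of two homogeneous
polynomials of degree d, written in terms of the plain coefficients of p and q. -/
noncomputable def apolar {m : ℕ} (p q : MvPolynomial (Fin m) ℂ) : ℂ :=
  ∑ α ∈ p.support ∩ q.support,
    (starRingEnd ℂ) (MvPolynomial.coeff α p) * MvPolynomial.coeff α q /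
      (Nat.multinomial α.support α : ℂ)

/-- The monomial `X^γ`. -/
noncomputable def monomOf {m : ℕ} (γ : Fin m → ℕ) : MvPolynomial (Fin m) ℂ :=
  ∏ i, X i ^ γ i

/-- The Hankel matrix `H_T^{k,d-k}`: rows indexed by exponents α with |α| = k, columns
indexed by exponents β with |β| = d-k, entries `⟨T, X^{α+β}⟩_d`. -/
noncomputable def hankel (m d k : ℕ) (T : MvPolynomial (Fin m) ℂ) :
    Matrix (Finset.Nat.antidiagonalTuple m k) (Finset.Nat.antidiagonalTuple m (d - k)) ℂ :=
  fun α β => apolar T (monomOf ((α : Fin m → ℕ) + (β : Fin m → ℕ)))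

/-- The vector `ξ^{(k)} = (ξ^α)_{|α|=k}`. -/
noncomputable def powVec {m : ℕ} (k : ℕ) (ξ : Fin m → ℂ) :
    Finset.Nat.antidiagonalTuple m k → ℂ :=
  fun α => ∏ j, ξ j ^ (α : Fin m → ℕ) j


/-- The interpolation degree ι(Ξ) of Ξ = {ξ₁,…,ξ_r}: the smallest k for which there is a
family of homogeneous interpolation polynomials of degree k at the points Ξ. -/
noncomputable def interpolationDegree {r m : ℕ} (ξ : Fin r → Fin m → ℂ) : ℕ :=
  sInf {k | ∃ u : Fin r → MvPolynomial (Fin m) ℂ,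
    (∀ i, (u i).IsHomogeneous k) ∧
    ∀ i j, MvPolynomial.eval (ξ j) (u i) = if i = j then 1 else 0}

/-- The submatrix `U_i` of `U` formed by the rows indexed by the exponents divisible by
`X_i`, i.e. of the form `e_i + α` with `|α| = k-1` (`e_i` the i-th unit exponent). -/
noncomputable def subRows {m k r : ℕ} (i : Fin m)
    (U : Matrix (Finset.Nat.antidiagonalTuple m k) (Fin r) ℂ) :
    Matrix (Finset.Nat.antidiagonalTuple m (k - 1)) (Fin r) ℂ :=
  fun α j =>
    if h : (fun l => (if l = i then 1 else 0) + (α : Fin m → ℕ) l) ∈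
        Finset.Nat.antidiagonalTuple m k
    then U ⟨_, h⟩ j else 0

theorem aux_coeff_linForm_pow {m : ℕ} (v : Fin m → ℂ) (s : Fin m →₀ ℕ) (d : ℕ)
    (hs : ∑ i, s i = d) :
    coeff s (linForm v ^ d) = (Nat.multinomial s.support s : ℂ) * ∏ i, v i ^ s i := by
  have h := coeff_linearCombination_X_pow_of_fintype v s d
  rw [if_pos (by rw [Finsupp.sum_fintype _ _ (by simp)]; exact hs), Finsupp.multinomial_eq,
    Finsupp.prod_fintype _ _ (by simp)] at h
  rw [← h]
  simp [linForm, smul_eq_C_mul]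

theorem aux_monomOf {m : ℕ} (s : Fin m →₀ ℕ) :
    monomOf (s : Fin m → ℕ) = monomial s 1 := by
  rw [monomial_eq, Finsupp.prod_fintype _ _ (by simp)]
  simp [monomOf]

theorem aux_apolar {m : ℕ} (T : MvPolynomial (Fin m) ℂ) (s : Fin m →₀ ℕ) :
    apolar T (monomOf (s : Fin m → ℕ)) =
      (starRingEnd ℂ) (coeff s T) / (Nat.multinomial s.support s : ℂ) := by
  classical
  rw [aux_monomOf, apolar, support_monomial, if_neg one_ne_zero]
  by_cases h : s ∈ T.support
  · rw [Finset.inter_singleton_of_mem h]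
    simp
  · rw [Finset.inter_singleton_of_notMem h]
    rw [notMem_support_iff] at h
    simp [h]

/-- The conjugate Vandermonde matrix. -/
noncomputable def auxV {m r : ℕ} (n : ℕ) (ξ : Fin r → Fin m → ℂ) :
    Matrix (Finset.Nat.antidiagonalTuple m n) (Fin r) ℂ :=
  fun α j => (starRingEnd ℂ) (powVec n (ξ j) α)

theorem aux_hankel {m d k r : ℕ} (ω : Fin r → ℂ) (ξ : Fin r → Fin m → ℂ) (hkd : k ≤ d) :
    hankel m d k (∑ i, C (ω i) * linForm (ξ i) ^ d) =
      auxV k ξ * (Matrix.of fun i β => (starRingEnd ℂ) (ω i) * auxV (d - k) ξ β i) := by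
  ext α β
  have hα := Finset.Nat.mem_antidiagonalTuple.1 α.2
  have hβ := Finset.Nat.mem_antidiagonalTuple.1 β.2
  set s : Fin m →₀ ℕ := Finsupp.equivFunOnFinite.symm ((α : Fin m → ℕ) + (β : Fin m → ℕ)) with hsdef
  have hs : ((s : Fin m →₀ ℕ) : Fin m → ℕ) = (α : Fin m → ℕ) + (β : Fin m → ℕ) := by
    simp [hsdef]
  have hsum : ∑ i, s i = d := by
    rw [hs]
    simp only [Pi.add_apply, Finset.sum_add_distrib, hα, hβ]
    omega
  have hne : (Nat.multinomial s.support s : ℂ) ≠ 0 := by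
    exact_mod_cast (Nat.multinomial_pos _ _).ne'
  rw [hankel, ← hs, aux_apolar, Matrix.mul_apply, div_eq_iff hne]
  simp only [coeff_sum, coeff_C_mul, aux_coeff_linForm_pow _ s d hsum, map_sum, map_mul,
    Complex.conj_natCast, Matrix.of_apply, Finset.sum_mul]
  refine Finset.sum_congr rfl fun i _ => ?_
  have : ∏ x, ξ i x ^ s x = powVec k (ξ i) α * powVec (d - k) (ξ i) β := by
    simp only [powVec, hs, Pi.add_apply, pow_add, Finset.prod_mul_distrib]
  rw [this, auxV, auxV, map_mul]
  ring

theorem aux_interp {m r : ℕ} (ξ : Fin r → Fin m → ℂ) (hξ0 : ∀ i, ξ i ≠ 0)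
    (hlines : ∀ i j, i ≠ j → ∀ c : ℂ, ξ i ≠ c • ξ j) (n : ℕ)
    (hn : interpolationDegree ξ ≤ n) :
    ∃ u : Fin r → MvPolynomial (Fin m) ℂ,
    (∀ i, (u i).IsHomogeneous n) ∧
    ∀ i j, MvPolynomial.eval (ξ j) (u i) = if i = j then 1 else 0 := by
  classical
  have hlin : ∀ i j, ∃ l : MvPolynomial (Fin m) ℂ, l.IsHomogeneous 1 ∧
      (i ≠ j → eval (ξ j) l = 0) ∧ eval (ξ i) l = 1 := by
    intro i j
    by_cases hij : i = j
    · obtain ⟨a, ha⟩ := Function.ne_iff.1 (hξ0 i)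
      simp only [Pi.zero_apply] at ha
      refine ⟨C (ξ i a)⁻¹ * X a, ?_, fun h => absurd hij h, by simp [ha]⟩
      simpa using (isHomogeneous_C (Fin m) (ξ i a)⁻¹).mul (isHomogeneous_X ℂ a)
    · obtain ⟨a, ha⟩ := Function.ne_iff.1 (hξ0 j)
      simp only [Pi.zero_apply] at ha
      obtain ⟨b, hb⟩ := Function.ne_iff.1 (hlines i j hij (ξ i a / ξ j a))
      simp only [Pi.smul_apply, smul_eq_mul] at hb
      have hD : ξ j b * ξ i a - ξ j a * ξ i b ≠ 0 := by
        intro h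
        apply hb
        field_simp
        linear_combination -h
      set D := ξ j b * ξ i a - ξ j a * ξ i b with hDdef
      refine ⟨C (D⁻¹) * (C (ξ j b) * X a - C (ξ j a) * X b), ?_, ?_, ?_⟩
      · have h1 : (C (ξ j b) * X a : MvPolynomial (Fin m) ℂ).IsHomogeneous 1 := by
          simpa using (isHomogeneous_C (Fin m) (ξ j b)).mul (isHomogeneous_X ℂ a)
        have h2 : (C (ξ j a) * X b : MvPolynomial (Fin m) ℂ).IsHomogeneous 1 := by
          simpa using (isHomogeneous_C (Fin m) (ξ j a)).mul (isHomogeneous_X ℂ b)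
        simpa using (isHomogeneous_C (Fin m) D⁻¹).mul (h1.sub h2)
      · intro _
        simp
        right
        ring
      · simp only [map_mul, map_sub, eval_C, eval_X, ← hDdef]
        exact inv_mul_cancel₀ hD
  choose l hl1 hl2 hl3 using hlin
  have hne : {k | ∃ u : Fin r → MvPolynomial (Fin m) ℂ,
      (∀ i, (u i).IsHomogeneous k) ∧
      ∀ i j, MvPolynomial.eval (ξ j) (u i) = if i = j then 1 else 0}.Nonempty := by
    refine ⟨∑ _j : Fin r, 1, fun i => ∏ j, l i j, fun i => ?_, fun i j => ?_⟩
    · exact IsHomogeneous.prod _ _ _ fun j _ => hl1 i j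
    · rw [map_prod]
      split_ifs with h
      · subst h
        exact Finset.prod_eq_one fun j _ => hl3 i j
      · exact Finset.prod_eq_zero (Finset.mem_univ j) (hl2 i j h)
  obtain ⟨u, hu1, hu2⟩ := Nat.sInf_mem hne
  refine ⟨fun i => u i * l i i ^ (n - interpolationDegree ξ), fun i => ?_, fun i j => ?_⟩
  · have := (hu1 i).mul ((hl1 i i).pow (n - interpolationDegree ξ))
    convert this using 1
    change n = interpolationDegree ξ + _
    omega
  · rw [map_mul, map_pow, hu2]
    split_ifs with h
    · subst h
      simp [hl3]
    · simp

theorem aux_linInd {m r : ℕ} (ξ : Fin r → Fin m → ℂ) (n : ℕ)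
    (u : Fin r → MvPolynomial (Fin m) ℂ) (hu1 : ∀ i, (u i).IsHomogeneous n)
    (hu2 : ∀ i j, MvPolynomial.eval (ξ j) (u i) = if i = j then 1 else 0) :
    LinearIndependent ℂ (fun j α => auxV n ξ α j) := by
  rw [Fintype.linearIndependent_iff]
  intro c hc i
  have h1 : ∀ α : Fin m →₀ ℕ, ∑ x, α x = n →
      ∑ j, (starRingEnd ℂ) (c j) * ∏ x, ξ j x ^ α x = 0 := by
    intro α hα
    have := congrFun hc ⟨α, Finset.Nat.mem_antidiagonalTuple.2 hα⟩
    have := congrArg (starRingEnd ℂ) this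
    simpa [auxV, powVec] using this
  have h2 : ∑ j, (starRingEnd ℂ) (c j) * eval (ξ j) (u i) = 0 := by
    simp only [eval_eq', Finset.mul_sum]
    rw [Finset.sum_comm]
    refine Finset.sum_eq_zero fun α hα => ?_
    have hdeg : ∑ x, α x = n := by
      have := hu1 i (mem_support_iff.1 hα)
      rw [Finsupp.weight_apply, Finsupp.sum_fintype _ _ (by simp)] at this
      simpa using this
    have := h1 α hdeg
    calc _ = coeff α (u i) * ∑ j, (starRingEnd ℂ) (c j) * ∏ x, ξ j x ^ α x := by
          rw [Finset.mul_sum]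
          exact Finset.sum_congr rfl fun j _ => by ring
      _ = 0 := by rw [this, mul_zero]
  simpa [hu2] using h2

theorem aux_normal {s : Type*} [Fintype s] [DecidableEq s] {r : ℕ} (V : Matrix s (Fin r) ℂ)
    (hV : LinearIndependent ℂ (fun j α => V α j)) :
    ∃ (E : Matrix s s ℂ) (ρ : Fin r ↪ s), IsUnit E ∧
      ∀ α j, (Eᵀ * V) α j = if α = ρ j then 1 else 0 := by
  classical
  let b := Module.Basis.extend hV.linearIndepOn_id
  haveI : Fintype (hV.linearIndepOn_id.extend (Set.subset_univ _)) :=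
    FiniteDimensional.fintypeBasisIndex b
  have hcard : Fintype.card (hV.linearIndepOn_id.extend (Set.subset_univ _)) = Fintype.card s := by
    rw [← Module.finrank_eq_card_basis b, Module.finrank_fintype_fun_eq_card]
  let e := Fintype.equivOfCardEq hcard
  let b' := b.reindex e
  let idx : Fin r → hV.linearIndepOn_id.extend (Set.subset_univ _) := fun j =>
    ⟨fun α => V α j, hV.linearIndepOn_id.subset_extend _ ⟨j, rfl⟩⟩
  let ρ : Fin r ↪ s := ⟨fun j => e (idx j), fun i j h => by
    have := congrArg Subtype.val (e.injective h)
    exact hV.injective this⟩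
  have hb : ∀ j, b' (ρ j) = fun α => V α j := by
    intro j
    have h1 : b' (ρ j) = b (idx j) := by
      change (b.reindex e) (e (idx j)) = _
      rw [Module.Basis.reindex_apply, Equiv.symm_apply_apply]
    rw [h1]
    simp [b, idx]
  refine ⟨(LinearMap.toMatrix' (b'.equivFun : (s → ℂ) →ₗ[ℂ] (s → ℂ)))ᵀ, ρ, ?_, ?_⟩
  · rw [Matrix.isUnit_transpose, ← Matrix.mulVec_injective_iff_isUnit]
    intro x y h
    simp only [LinearMap.toMatrix'_mulVec] at h
    exact b'.equivFun.injective h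
  · intro α j
    rw [Matrix.transpose_transpose]
    have : (LinearMap.toMatrix' (b'.equivFun : (s → ℂ) →ₗ[ℂ] (s → ℂ)) * V) α j =
      (LinearMap.toMatrix' (b'.equivFun : (s → ℂ) →ₗ[ℂ] (s → ℂ)) *ᵥ (fun α => V α j)) α := rfl
    rw [this, LinearMap.toMatrix'_mulVec, ← hb]
    simp [Finsupp.single_apply, eq_comm]

theorem aux_F {s t : Type*} [Fintype s] [DecidableEq s] [Fintype t] [DecidableEq t] {r : ℕ}
    (U V : Matrix s (Fin r) ℂ) (H : Matrix s t ℂ) (W : Matrix (Fin r) t ℂ) (hH : H = V * W)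
    (hrank : H.rank = r)
    (hU : LinearMap.range U.mulVecLin = LinearMap.range H.mulVecLin) :
    ∃ F : Matrix (Fin r) (Fin r) ℂ, IsUnit F ∧ U * F = V := by
  have hle : LinearMap.range H.mulVecLin ≤ LinearMap.range V.mulVecLin := by
    rw [hH, Matrix.mulVecLin_mul]
    exact LinearMap.range_comp_le_range _ _
  have hVr : V.rank ≤ r := by simpa using V.rank_le_card_width
  have heq : LinearMap.range H.mulVecLin = LinearMap.range V.mulVecLin :=
    Submodule.eq_of_le_of_finrank_le hle (by
      change V.rank ≤ H.rank
      rw [hrank]; exact hVr)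
  have hVrank : V.rank = r := by
    rw [Matrix.rank, ← heq]; exact hrank
  have hinj : Function.Injective V.mulVecLin := by
    rw [← LinearMap.ker_eq_bot, ← Submodule.finrank_eq_zero]
    have := LinearMap.finrank_range_add_finrank_ker V.mulVecLin
    rw [Module.finrank_fintype_fun_eq_card, Fintype.card_fin] at this
    have h2 : Module.finrank ℂ (LinearMap.range V.mulVecLin) = r := hVrank
    omega
  have hex : ∀ j, ∃ x, U.mulVecLin x = fun α => V α j := by
    intro j
    have : (fun α => V α j) ∈ LinearMap.range U.mulVecLin := by
      rw [hU, heq]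
      exact ⟨Pi.single j 1, by ext α; simp⟩
    exact this
  choose f hf using hex
  have hUF : U * (Matrix.of fun i j => f j i) = V := by
    ext α j
    have := congrFun (hf j) α
    exact this
  refine ⟨Matrix.of fun i j => f j i, ?_, hUF⟩
  rw [← Matrix.mulVec_injective_iff_isUnit]
  intro x y h
  apply hinj
  simp only [Matrix.mulVecLin_apply]
  rw [← hUF, ← Matrix.mulVec_mulVec, ← Matrix.mulVec_mulVec]
  exact congrArg _ h

theorem aux_subRows {m k r : ℕ} (hk : 1 ≤ k) (ξ : Fin r → Fin m → ℂ)
    (U : Matrix (Finset.Nat.antidiagonalTuple m k) (Fin r) ℂ) (F : Matrix (Fin r) (Fin r) ℂ)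
    (hUF : U * F = auxV k ξ) (i : Fin m) :
    subRows i U * F =
      auxV (k - 1) ξ * Matrix.diagonal (fun j => (starRingEnd ℂ) (ξ j i)) := by
  ext α j
  have hα := Finset.Nat.mem_antidiagonalTuple.1 α.2
  have hmem : (fun l => (if l = i then 1 else 0) + (α : Fin m → ℕ) l) ∈
        Finset.Nat.antidiagonalTuple m k := by
    rw [Finset.Nat.mem_antidiagonalTuple, Finset.sum_add_distrib, hα]
    simp
    omega
  have h1 : (subRows i U * F) α j = (U * F) ⟨_, hmem⟩ j := by
    rw [Matrix.mul_apply, Matrix.mul_apply]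
    refine Finset.sum_congr rfl fun x _ => ?_
    rw [subRows, dif_pos hmem]
  rw [h1, hUF, Matrix.mul_diagonal, auxV, auxV, ← map_mul]
  congr 1
  simp only [powVec, pow_add, Finset.prod_mul_distrib]
  rw [mul_comm]
  congr 1
  simp

/-- under the hypotheses of the identifiability theorem, for any matrix U
whose column space is the column space of H_T^{k,d-k}, the pencil U₁,…,Uₘ of submatrices
can be simultaneously diagonalised: there are invertible E, F such that each Eᵀ Uᵢ F is,
up to the ordering of its rows (encoded by the injection ρ selecting the "top r rows"),
the matrix with top r×r block diag(conj ξ_{1,i},…,conj ξ_{r,i}) and zero remaining rows. -/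
theorem statement_18 (m d k r : ℕ)
    (ω : Fin r → ℂ) (hω : ∀ i, ω i ≠ 0)
    (ξ : Fin r → Fin m → ℂ) (hξ0 : ∀ i, ξ i ≠ 0)
    (hlines : ∀ i j, i ≠ j → ∀ c : ℂ, ξ i ≠ c • ξ j)
    (T : MvPolynomial (Fin m) ℂ) (hT : T = ∑ i, C (ω i) * linForm (ξ i) ^ d)
    (hk1 : interpolationDegree ξ + 1 ≤ k) (hkd : k ≤ d)
    (hrank : (hankel m d k T).rank = r)
    (U : Matrix (Finset.Nat.antidiagonalTuple m k) (Fin r) ℂ)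
    (hU : LinearMap.range U.mulVecLin = LinearMap.range (hankel m d k T).mulVecLin) :
    ∃ (E : Matrix (Finset.Nat.antidiagonalTuple m (k - 1))
          (Finset.Nat.antidiagonalTuple m (k - 1)) ℂ)
      (F : Matrix (Fin r) (Fin r) ℂ)
      (ρ : Fin r ↪ Finset.Nat.antidiagonalTuple m (k - 1)),
      IsUnit E ∧ IsUnit F ∧
      ∀ (i : Fin m) (α : Finset.Nat.antidiagonalTuple m (k - 1)) (j : Fin r),
        (Eᵀ * subRows i U * F) α j
          = if α = ρ j then (starRingEnd ℂ) (ξ j i) else 0 := by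
  obtain ⟨u, hu1, hu2⟩ := aux_interp ξ hξ0 hlines (k - 1) (by omega)
  obtain ⟨E, ρ, hE, hEV⟩ := aux_normal _ (aux_linInd ξ (k - 1) u hu1 hu2)
  obtain ⟨F, hF, hUF⟩ := aux_F U (auxV k ξ) (hankel m d k T) _
    (by rw [hT]; exact aux_hankel ω ξ hkd) hrank hU
  refine ⟨E, F, ρ, hE, hF, fun i α j => ?_⟩
  rw [Matrix.mul_assoc, aux_subRows (by omega) ξ U F hUF i, ← Matrix.mul_assoc,
    Matrix.mul_diagonal, hEV]
  split_ifs <;> simp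
end
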